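/- arXiv:2002.07738 — 2 statements merged into one kernel-verified Lean document; each statement's English description precedes it below -/
import Mathlib

section
/- Let D be a weighted L¹ metric on ℝ^d with weights w₁,…,w_d > 0, and g(t) ∝ exp(-2D(0,t)) the associated Laplace smoothing density. Then D is the unique minimal weighted L¹ metric with respect to g: the smoothed model of every f : ℝ^d → {0,1} is individually fair under D, and for any weighted L¹ metric D' pointwise-dominated by D with D' ≠ D, there exists f such that the smoothed model of f is not individually fair under D'. -/
theorem aux_tanh (D δ : ℝ) (hD : 0 ≤ D) (hδ : δ ≤ 1)
    (h : 1 + δ ≤ Real.exp (2 * D) * (1 - δ)) : δ ≤ D := by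
  by_contra hlt
  push Not at hlt
  have hD1 : D < 1 := lt_of_lt_of_le hlt hδ
  have hs := Real.hasSum_log_sub_log_of_abs_lt_one (x := D) (by rw [abs_of_nonneg hD]; exact hD1)
  have h1 : 2 * D ≤ Real.log (1 + D) - Real.log (1 - D) := by
    have := hs.summable.le_tsum 0 (fun j _ => by positivity)
    rw [hs.tsum_eq] at this
    simpa using this
  have h2 : Real.exp (2 * D) ≤ (1 + D) / (1 - D) := by
    rw [← Real.log_div (by linarith) (by linarith)] at h1
    rwa [Real.le_log_iff_exp_le (div_pos (by linarith) (by linarith))] at h1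
  rw [le_div_iff₀ (by linarith)] at h2
  have h3 : 0 < Real.exp (2 * D) := Real.exp_pos _
  nlinarith

open Finset MeasureTheory Classical in
theorem stmt_8 {d : ℕ} (w : Fin d → ℝ) (hw : ∀ i, 0 < w i)
    (D : (Fin d → ℝ) → (Fin d → ℝ) → ℝ)
    (hD : ∀ x1 x2, D x1 x2 = ∑ i, w i * |x1 i - x2 i|)
    (Z : ℝ) (hZ : Z = ∫ t : Fin d → ℝ, Real.exp (-2 * D 0 t)) (hZpos : 0 < Z)
    (g : (Fin d → ℝ) → ℝ) (hg : ∀ t, g t = Real.exp (-2 * D 0 t) / Z)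
    (sm : ((Fin d → ℝ) → Bool) → (Fin d → ℝ) → Bool → ℝ)
    (hsm : ∀ f x y, sm f x y = ∫ t : Fin d → ℝ, (if f (x + t) = y then (1 : ℝ) else 0) * g t) :
    (∀ f : (Fin d → ℝ) → Bool, Measurable f →
      ∀ x1 x2, (1 / 2) * ∑ y, |sm f x1 y - sm f x2 y| ≤ D x1 x2) ∧
    (∀ w' : Fin d → ℝ, (∀ i, 0 ≤ w' i) →
      ∀ D' : (Fin d → ℝ) → (Fin d → ℝ) → ℝ,
        (∀ x1 x2, D' x1 x2 = ∑ i, w' i * |x1 i - x2 i|) →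
        (∀ x1 x2, D' x1 x2 ≤ D x1 x2) → D' ≠ D →
        ∃ f : (Fin d → ℝ) → Bool, Measurable f ∧
          ¬ (∀ x1 x2, (1 / 2) * ∑ y, |sm f x1 y - sm f x2 y| ≤ D' x1 x2)) := by
  have hD0 : ∀ x1 x2, 0 ≤ D x1 x2 := fun x1 x2 => by
    rw [hD]; exact Finset.sum_nonneg fun i _ => mul_nonneg (hw i).le (abs_nonneg _)
  have hint0 : Integrable (fun t : Fin d → ℝ => Real.exp (-2 * D 0 t)) := by
    by_contra h
    rw [integral_undef h] at hZ
    linarith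
  have hgeq : g = fun t => Real.exp (-2 * D 0 t) / Z := funext hg
  have hgint : Integrable g := by rw [hgeq]; exact hint0.div_const Z
  have hg1 : ∫ t, g t = 1 := by
    rw [hgeq, integral_div, ← hZ, div_self hZpos.ne']
  have hg0 : ∀ t, 0 ≤ g t := fun t => by rw [hg]; positivity
  -- integrability
  have hI : ∀ f : (Fin d → ℝ) → Bool, Measurable f → ∀ x y,
      Integrable (fun t => (if f (x + t) = y then (1 : ℝ) else 0) * g t) := by
    intro f hf x y
    refine hgint.bdd_mul (c := 1) ?_ ?_
    · apply Measurable.aestronglyMeasurable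
      refine Measurable.ite ?_ measurable_const measurable_const
      exact (hf.comp (measurable_const_add x)) (measurableSet_singleton y)
    · filter_upwards with t
      split_ifs <;> simp
  have hsum : ∀ f : (Fin d → ℝ) → Bool, Measurable f → ∀ x, sm f x true + sm f x false = 1 := by
    intro f hf x
    rw [hsm, hsm, ← integral_add (hI f hf x true) (hI f hf x false)]
    refine Eq.trans ?_ hg1
    congr 1
    ext t
    cases f (x + t) <;> simp
  have hnn : ∀ f x y, 0 ≤ sm f x y := by
    intro f x y
    rw [hsm]
    refine integral_nonneg fun t => mul_nonneg ?_ (hg0 t)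
    split_ifs <;> simp
  have htv : ∀ f : (Fin d → ℝ) → Bool, Measurable f → ∀ x1 x2,
      (1 / 2) * ∑ y, |sm f x1 y - sm f x2 y| = |sm f x1 true - sm f x2 true| := by
    intro f hf x1 x2
    have h1 := hsum f hf x1
    have h2 := hsum f hf x2
    have h3 : sm f x1 false - sm f x2 false = -(sm f x1 true - sm f x2 true) := by linarith
    rw [Fintype.sum_bool, h3, abs_neg]
    ring
  have hdsymm : ∀ x1 x2, D x1 x2 = D x2 x1 := by
    intro x1 x2
    simp only [hD, abs_sub_comm]
  have hshift : ∀ f x y z, sm f x y =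
      ∫ t : Fin d → ℝ, (if f (x + z + t) = y then (1 : ℝ) else 0) * g (z + t) := by
    intro f x y z
    rw [hsm, ← integral_add_left_eq_self _ z]
    simp only [add_assoc]
  constructor
  · intro f hf
    have hle : ∀ x1 x2 y, sm f x1 y ≤ Real.exp (2 * D x1 x2) * sm f x2 y := by
      intro x1 x2 y
      rw [hshift f x1 y (x2 - x1), hsm f x2, ← integral_const_mul]
      have e : x1 + (x2 - x1) = x2 := by abel
      rw [e]
      refine integral_mono_of_nonneg ?_ ((hI f hf x2 y).const_mul _) ?_
      · filter_upwards with t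
        refine mul_nonneg ?_ (hg0 _)
        split_ifs <;> simp
      · filter_upwards with t
        have hgg : g (x2 - x1 + t) ≤ Real.exp (2 * D x1 x2) * g t := by
          rw [hg, hg, ← mul_div_assoc, ← Real.exp_add]
          apply div_le_div_of_nonneg_right _ hZpos.le
          apply Real.exp_le_exp.mpr
          have : D 0 t ≤ D x1 x2 + D 0 (x2 - x1 + t) := by
            rw [hD, hD, hD, ← Finset.sum_add_distrib]
            refine Finset.sum_le_sum fun i _ => ?_
            rw [← mul_add]
            refine mul_le_mul_of_nonneg_left ?_ (hw i).le
            have := abs_sub_le (0 : ℝ) (x2 i - x1 i + t i) (t i)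
            have e2 : x2 i - x1 i + t i - t i = -(x1 i - x2 i) := by ring
            rw [e2, abs_neg] at this
            simp only [Pi.zero_apply, Pi.add_apply, Pi.sub_apply] at *
            linarith
          linarith
        show _ * _ ≤ _ * (_ * _)
        split_ifs
        · simpa using hgg
        · simp
    have key : ∀ x1 x2, sm f x1 true - sm f x2 true ≤ D x1 x2 := by
      intro x1 x2
      have s1 := hsum f hf x1
      have s2 := hsum f hf x2
      have a := hle x1 x2 true
      have b := hle x2 x1 false
      rw [hdsymm x2 x1] at b
      refine aux_tanh _ _ (hD0 _ _) (by linarith [hnn f x1 false, hnn f x2 true]) ?_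
      have e1 : sm f x1 false = 1 - sm f x1 true := by linarith
      have e2 : sm f x2 false = 1 - sm f x2 true := by linarith
      rw [e1, e2] at b
      nlinarith
    intro x1 x2
    rw [htv f hf, abs_le]
    have := key x2 x1
    rw [hdsymm] at this
    exact ⟨by linarith, key x1 x2⟩
  · intro w' hw' D' hD' hle hne
    have hwle : ∀ i, w' i ≤ w i := by
      intro i
      have := hle (Pi.single i 1) 0
      rw [hD, hD'] at this
      simpa [Pi.single_apply, apply_ite] using this
    obtain ⟨i, hi⟩ : ∃ i, w' i < w i := by
      by_contra hcon
      push Not at hcon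
      apply hne
      have : w' = w := funext fun i => le_antisymm (hwle i) (hcon i)
      ext x1 x2
      rw [hD, hD', this]
    have hwi := hw i
    have hwi' := hw' i
    set f : (Fin d → ℝ) → Bool := fun x => decide (0 ≤ x i) with hf
    have hfm : Measurable f := by
      refine measurable_to_bool ?_
      have : f ⁻¹' {true} = {x | 0 ≤ x i} := by ext x; simp [hf]
      rw [this]
      exact measurableSet_le measurable_const (measurable_pi_apply i)
    refine ⟨f, hfm, fun hall => ?_⟩
    obtain ⟨δ, hδ, hδ2⟩ : ∃ δ : ℝ, 0 < δ ∧ 2 * w i * w' i * δ < w i - w' i := by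
      refine ⟨(w i - w' i) / (2 * w i * (w' i + w i)), div_pos (by linarith) (by positivity), ?_⟩
      rw [← mul_div_assoc, div_lt_iff₀ (by positivity)]
      have : 0 < (w i - w' i) * (w i * w i) := mul_pos (by linarith) (by positivity)
      nlinarith
    have hhalf : 1 / 2 ≤ sm f 0 true := by
      have hneg : sm f 0 false ≤ sm f 0 true := by
        rw [hsm, hsm, ← integral_neg_eq_self]
        refine integral_mono_of_nonneg ?_ (hI f hfm 0 true) ?_
        · filter_upwards with t
          refine mul_nonneg ?_ (hg0 _)
          split_ifs <;> simp
        · filter_upwards with t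
          have : g (-t) = g t := by
            rw [hg, hg, hD, hD]; simp
          show _ * _ ≤ _ * _
          rw [this]
          refine mul_le_mul_of_nonneg_right ?_ (hg0 t)
          by_cases h : 0 ≤ t i
          · simp only [hf, zero_add, h, decide_true, if_true]
            split_ifs <;> simp
          · have h' : 0 ≤ - t i := by linarith
            simp [hf, h, h'.trans]
            try linarith
      have := hsum f hfm 0
      linarith
    have hsh : sm f (-Pi.single i δ) true = Real.exp (-2 * (w i * δ)) * sm f 0 true := by
      rw [hshift f _ true (Pi.single i δ), hsm f 0, ← integral_const_mul]
      congr 1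
      ext t
      rw [neg_add_cancel]
      by_cases h : 0 ≤ t i
      · simp only [hf, zero_add, h, decide_true, if_true, one_mul]
        rw [hg, hg, ← mul_div_assoc, ← Real.exp_add]
        congr 2
        have : D 0 (Pi.single i δ + t) = w i * δ + D 0 t := by
          rw [hD, hD, ← Finset.add_sum_erase _ _ (Finset.mem_univ i),
            ← Finset.add_sum_erase _ (fun j => w j * |(0 : Fin d → ℝ) j - t j|)
              (Finset.mem_univ i), ← add_assoc]
          congr 1
          · simp only [Pi.zero_apply, Pi.add_apply, Pi.single_eq_same, zero_sub, abs_neg]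
            rw [abs_of_nonneg h, abs_of_nonneg (by linarith)]
            ring
          · refine Finset.sum_congr rfl fun j hj => ?_
            simp [Pi.single_eq_of_ne (Finset.ne_of_mem_erase hj)]
        rw [this]
        ring
      · simp [hf, h]
    have hfin := hall 0 (-Pi.single i δ)
    rw [htv f hfm, hsh] at hfin
    have hD'v : D' 0 (-Pi.single i δ) = w' i * δ := by
      rw [hD']
      simp [Pi.single_apply, apply_ite, abs_of_pos hδ]
    rw [hD'v] at hfin
    have hfin2 := (le_abs_self _).trans hfin
    have ha : 0 < w i * δ := by positivity
    have hE : Real.exp (-2 * (w i * δ)) * (1 + 2 * (w i * δ)) ≤ 1 := by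
      have h1 := Real.add_one_le_exp (2 * (w i * δ))
      have h2 : Real.exp (-2 * (w i * δ)) * Real.exp (2 * (w i * δ)) = 1 := by
        rw [← Real.exp_add]; simp
      nlinarith [Real.exp_pos (-2 * (w i * δ))]
    generalize Real.exp (-2 * (w i * δ)) = E at *
    have hE1 : E ≤ 1 := by nlinarith
    have h4 : (1 - E) ≤ 2 * (w' i * δ) := by nlinarith
    have h5 : 2 * (w i * δ) ≤ (1 - E) * (1 + 2 * (w i * δ)) := by nlinarith
    have h6 : 2 * (w i * δ) ≤ 2 * (w' i * δ) * (1 + 2 * (w i * δ)) :=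
      h5.trans (mul_le_mul_of_nonneg_right h4 (by linarith))
    have h7 : δ * (2 * w i * w' i * δ) < δ * (w i - w' i) := mul_lt_mul_of_pos_left hδ2 hδ
    nlinarith
end

section
/- Let w₁,…,w_d > 0, Σ diagonal with Σᵢᵢ = (2πwᵢ)^{-1}, and g the density of N(0,Σ). For any f : ℝ^d → {0,1}, the smoothed model ĝf(x)[1] = ∫ 1[f(x+t)=1]·g(t) dt satisfies, for all x, ε ∈ ℝ^d: |ĝf(x+ε)[1] - ĝf(x)[1]| ≤ √(Σᵢ wᵢ·εᵢ²). -/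
open MeasureTheory ProbabilityTheory in
/-- The linear functional `t ↦ ∑ aᵢ tᵢ` of the product Gaussian density is Gaussian. -/
theorem aux_map_gaussian {d : ℕ} (S : Fin d → NNReal) (hS : ∀ i, S i ≠ 0)
    (a : Fin d → ℝ) (v : NNReal) (hv : (v : ℝ) = ∑ i, a i ^ 2 * S i)
    (g : (Fin d → ℝ) → ℝ) (hg : ∀ t, g t = ∏ i, gaussianPDFReal 0 (S i) (t i))
    (hgm : Measurable g) (hgi : Integrable g) :
    (volume.withDensity (fun t => ENNReal.ofReal (g t))).map (fun t => ∑ i, a i * t i)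
      = gaussianReal 0 v := by
  have hL : Measurable (fun t : Fin d → ℝ => ∑ i, a i * t i) := by fun_prop
  have hg0 : ∀ t, 0 ≤ g t := fun t => by
    rw [hg]; exact Finset.prod_nonneg fun i _ => gaussianPDFReal_nonneg _ _ _
  have : IsFiniteMeasure (volume.withDensity (fun t => ENNReal.ofReal (g t))) :=
    isFiniteMeasure_withDensity_ofReal hgi.2
  apply Measure.ext_of_charFun
  ext s
  rw [charFun_apply_real, integral_map hL.aemeasurable (by fun_prop),
    integral_withDensity_eq_integral_toReal_smul (by fun_prop) (by simp)]
  have h1 : ∀ t : Fin d → ℝ, (ENNReal.ofReal (g t)).toReal •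
      Complex.exp (s * ((∑ i, a i * t i : ℝ) : ℂ) * Complex.I)
      = ∏ i, (gaussianPDFReal 0 (S i) (t i) • Complex.exp (((s * a i : ℝ) : ℂ) * (t i : ℂ) * Complex.I)) := by
    intro t
    rw [ENNReal.toReal_ofReal (hg0 t), hg]
    simp only [Complex.real_smul, Finset.prod_mul_distrib, ← Complex.exp_sum]
    push_cast
    congr 2
    rw [Finset.mul_sum, Finset.sum_mul]
    exact Finset.sum_congr rfl fun i _ => by ring
  simp_rw [h1]
  rw [integral_fintype_prod_volume_eq_prod
    (fun i (x : ℝ) => gaussianPDFReal 0 (S i) x • Complex.exp (((s * a i : ℝ) : ℂ) * (x : ℂ) * Complex.I))]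
  have h2 : ∀ i, ∫ x : ℝ, gaussianPDFReal 0 (S i) x • Complex.exp (((s * a i : ℝ) : ℂ) * (x : ℂ) * Complex.I)
      = charFun (gaussianReal 0 (S i)) (s * a i) := by
    intro i
    rw [charFun_apply_real, integral_gaussianReal_eq_integral_smul (hS i)]
  simp_rw [h2, charFun_gaussianReal, ← Complex.exp_sum]
  congr 1
  have hv' : ((v : ℝ) : ℂ) = ∑ i, (a i : ℂ) ^ 2 * ((S i : ℝ) : ℂ) := by
    rw [hv]; push_cast; rfl
  rw [hv']
  simp only [Complex.ofReal_zero, mul_zero, zero_mul, zero_sub, Finset.sum_neg_distrib]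
  rw [Finset.sum_mul, Finset.sum_div]
  congr 1
  exact Finset.sum_congr rfl fun i _ => by push_cast; ring

open MeasureTheory ProbabilityTheory in
/-- An interval of length `l` has centred Gaussian mass at most `l / √(2πv)`. -/
theorem aux_Ico (v : NNReal) (hv : v ≠ 0) (b c : ℝ) (hbc : b ≤ c) :
    (gaussianReal 0 v).real (Set.Ico b c) ≤ (Real.sqrt (2 * Real.pi * v))⁻¹ * (c - b) := by
  rw [measureReal_def, gaussianReal_apply_eq_integral 0 hv,
    ENNReal.toReal_ofReal (integral_nonneg fun x => gaussianPDFReal_nonneg _ _ _)]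
  have : ∫ x in Set.Ico b c, gaussianPDFReal 0 v x ≤
      ∫ x in Set.Ico b c, (Real.sqrt (2 * Real.pi * v))⁻¹ := by
    apply integral_mono_of_nonneg
    · exact Filter.Eventually.of_forall fun x => gaussianPDFReal_nonneg _ _ _
    · exact integrable_const _
    · refine Filter.Eventually.of_forall fun x => ?_
      simp only [gaussianPDFReal]
      refine mul_le_of_le_one_right (by positivity) (Real.exp_le_one_iff.2 ?_)
      rw [neg_div]
      exact neg_nonpos.2 (by positivity)
  refine this.trans (le_of_eq ?_)
  simp [hbc, mul_comm]

open MeasureTheory ProbabilityTheory in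
theorem aux_one_side {d : ℕ} (w : Fin d → ℝ) (hw : ∀ i, 0 < w i)
    (S : Fin d → NNReal) (hS : ∀ i, (S i : ℝ) = (2 * Real.pi * w i)⁻¹)
    (g : (Fin d → ℝ) → ℝ) (hg : ∀ t, g t = ∏ i, gaussianPDFReal 0 (S i) (t i))
    (k : (Fin d → ℝ) → ℝ) (hkm : Measurable k) (hk0 : ∀ x, 0 ≤ k x) (hk1 : ∀ x, k x ≤ 1)
    (ε : Fin d → ℝ) :
    (∫ t, k (t + ε) * g t) - ∫ t, k t * g t ≤ Real.sqrt (∑ i, w i * (ε i) ^ 2) := by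
  have hpi := Real.pi_pos
  have hSpos : ∀ i, 0 < (S i : ℝ) := fun i => by
    rw [hS]; have := hw i; positivity
  have hS0 : ∀ i, S i ≠ 0 := fun i h => by have := hSpos i; simp [h] at this
  have hg0 : ∀ t, 0 ≤ g t := fun t => by
    rw [hg]; exact Finset.prod_nonneg fun i _ => gaussianPDFReal_nonneg _ _ _
  have hgf : g = fun t => ∏ i, gaussianPDFReal 0 (S i) (t i) := funext hg
  have hgm : Measurable g := by
    rw [hgf]
    exact Finset.measurable_prod _ fun i _ =>
      (measurable_gaussianPDFReal _ _).comp (measurable_pi_apply i)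
  have hgi : Integrable g := by
    rw [hgf]
    exact Integrable.fintype_prod (fun i => integrable_gaussianPDFReal 0 (S i))
  set q : ℝ := ∑ i, w i * (ε i) ^ 2 with hq
  have hq0 : 0 ≤ q := Finset.sum_nonneg fun i _ => mul_nonneg (hw i).le (sq_nonneg _)
  rcases hq0.eq_or_lt with hz | hqpos
  · have : ε = 0 := by
      ext i
      have := (Finset.sum_eq_zero_iff_of_nonneg
        (fun i _ => mul_nonneg (hw i).le (sq_nonneg (ε i)))).1 (hq.symm.trans hz.symm) i (Finset.mem_univ i)
      simpa [(hw i).ne'] using this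
    simp [this]
  set a : Fin d → ℝ := fun i => 2 * Real.pi * w i * ε i with ha
  set V : NNReal := ⟨2 * Real.pi * q, by positivity⟩ with hV
  have hVr : (V : ℝ) = 2 * Real.pi * q := rfl
  have hVpos : 0 < (V : ℝ) := by rw [hVr]; positivity
  have hV0 : V ≠ 0 := fun h => by simp [h] at hVpos
  set L : (Fin d → ℝ) → ℝ := fun t => ∑ i, a i * t i with hLdef
  have hL : Measurable L := by simp only [hLdef]; fun_prop
  have hmap : (volume.withDensity (fun t => ENNReal.ofReal (g t))).map L = gaussianReal 0 V := by
    refine aux_map_gaussian S hS0 a V ?_ g hg hgm hgi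
    rw [hVr, hq, Finset.mul_sum]
    refine Finset.sum_congr rfl fun i _ => ?_
    have := (hw i).ne'
    rw [hS, ha]; field_simp
  have hLadd : ∀ t, L (t + ε) = L t + V := by
    intro t
    rw [hVr, hq, Finset.mul_sum]
    simp only [hLdef, Pi.add_apply, mul_add, Finset.sum_add_distrib, ha]
    congr 1
    exact Finset.sum_congr rfl fun i _ => by ring
  -- the likelihood ratio
  have hratio : ∀ t, g (t - ε) = g t * Real.exp (L t - V / 2) := by
    intro t
    rw [hVr, hq, hLdef, hg, hg, Finset.mul_sum, Finset.sum_div, ← Finset.sum_sub_distrib,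
      Real.exp_sum, ← Finset.prod_mul_distrib]
    refine Finset.prod_congr rfl fun i _ => ?_
    simp only [gaussianPDFReal, Pi.sub_apply, mul_assoc, ← Real.exp_add]
    congr 2
    have := (hw i).ne'
    rw [hS, ha]; field_simp; ring
  -- integrability of bounded functions times g
  have hint : ∀ h : (Fin d → ℝ) → ℝ, Measurable h → (∀ x, 0 ≤ h x) → (∀ x, h x ≤ 1) →
      ∀ G : (Fin d → ℝ) → ℝ, Integrable G → Integrable (fun t => h t * G t) := by
    intro h hm h0 h1 G hG
    refine hG.bdd_mul (c := 1) hm.aestronglyMeasurable (Filter.Eventually.of_forall fun x => ?_)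
    rw [Real.norm_eq_abs, abs_of_nonneg (h0 x)]; exact h1 x
  have hgi' : Integrable (fun t => g (t - ε)) := hgi.comp_sub_right ε
  have hshift : ∀ h : (Fin d → ℝ) → ℝ, ∫ t, h (t + ε) * g t = ∫ t, h t * g (t - ε) := by
    intro h
    rw [← integral_add_right_eq_self (fun t => h t * g (t - ε)) ε]
    simp
  set A : Set (Fin d → ℝ) := {t | V / 2 ≤ L t} with hA
  have hAm : MeasurableSet A := measurableSet_le measurable_const hL
  set m : (Fin d → ℝ) → ℝ := A.indicator 1 with hm
  have hmm : Measurable m := measurable_one.indicator hAm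
  have hm0 : ∀ x, 0 ≤ m x := fun x => Set.indicator_nonneg (fun _ _ => zero_le_one) x
  have hm1 : ∀ x, m x ≤ 1 := fun x => Set.indicator_le_self' (fun _ _ => zero_le_one) x
  have key : (∫ t, k (t + ε) * g t) - ∫ t, k t * g t
      ≤ (∫ t, m (t + ε) * g t) - ∫ t, m t * g t := by
    rw [hshift, hshift, ← integral_sub (hint k hkm hk0 hk1 _ hgi') (hint k hkm hk0 hk1 _ hgi),
      ← integral_sub (hint m hmm hm0 hm1 _ hgi') (hint m hmm hm0 hm1 _ hgi)]
    refine integral_mono ((hint k hkm hk0 hk1 _ hgi').sub (hint k hkm hk0 hk1 _ hgi))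
      ((hint m hmm hm0 hm1 _ hgi').sub (hint m hmm hm0 hm1 _ hgi)) fun t => ?_
    simp only [← mul_sub]
    by_cases ht : t ∈ A
    · have : m t = 1 := by simp [hm, ht]
      rw [this]
      refine mul_le_mul_of_nonneg_right (hk1 t) ?_
      have h1 : 1 ≤ Real.exp (L t - V / 2) := Real.one_le_exp (sub_nonneg.2 ht)
      rw [hratio]; nlinarith [hg0 t]
    · have : m t = 0 := by simp [hm, ht]
      rw [this, zero_mul]
      refine mul_nonpos_of_nonneg_of_nonpos (hk0 t) ?_
      have h1 : Real.exp (L t - V / 2) ≤ 1 := Real.exp_le_one_iff.2 (by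
        have : ¬ ((V : ℝ) / 2 ≤ L t) := ht
        linarith)
      rw [hratio]; nlinarith [hg0 t]
  refine key.trans ?_
  set B : Set ℝ := Set.Ico (-(V / 2) : ℝ) (V / 2) with hB
  have heq : (∫ t, m (t + ε) * g t) - ∫ t, m t * g t = (gaussianReal 0 V).real B := by
    rw [← integral_sub (hint (fun t => m (t + ε)) (hmm.comp (measurable_add_const ε)) (fun x => hm0 _) (fun x => hm1 _) _ hgi)
      (hint m hmm hm0 hm1 _ hgi), ← hmap, measureReal_def, Measure.map_apply hL measurableSet_Ico,
      withDensity_apply _ (hL measurableSet_Ico), ← ofReal_integral_eq_lintegral_ofReal hgi.integrableOn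
        (Filter.Eventually.of_forall hg0), ENNReal.toReal_ofReal (integral_nonneg hg0),
      ← integral_indicator (hL measurableSet_Ico)]
    refine integral_congr_ae (Filter.Eventually.of_forall fun t => ?_)
    have hAdd := hLadd t
    have mA : ∀ y, m y = if (V : ℝ) / 2 ≤ L y then 1 else 0 := fun y => by
      by_cases hy : (V : ℝ) / 2 ≤ L y
      · rw [if_pos hy, hm, Set.indicator_of_mem (show y ∈ A from hy), Pi.one_apply]
      · rw [if_neg hy, hm, Set.indicator_of_notMem (show y ∉ A from hy)]
    change m (t + ε) * g t - m t * g t = (L ⁻¹' B).indicator g t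
    rw [mA, mA, hAdd]
    by_cases h1 : (V : ℝ) / 2 ≤ L t
    · rw [if_pos h1, if_pos (by linarith), Set.indicator_of_notMem (fun h => absurd h.2 (not_lt.2 h1)),
        sub_self]
    · rw [if_neg h1]
      by_cases h2 : (V : ℝ) / 2 ≤ L t + V
      · rw [if_pos h2, Set.indicator_of_mem
          (show t ∈ L ⁻¹' B from ⟨by linarith, not_le.1 h1⟩)]
        ring
      · rw [if_neg h2, Set.indicator_of_notMem (fun h => h2 (by have := h.1; linarith))]
        ring
  rw [heq]
  refine (aux_Ico V hV0 _ _ (by linarith)).trans (le_of_eq ?_)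
  have e1 : 2 * Real.pi * (V : ℝ) = (2 * Real.pi) ^ 2 * q := by rw [hVr]; ring
  rw [e1, Real.sqrt_mul (by positivity), Real.sqrt_sq (by positivity), hVr]
  have hs : 0 < Real.sqrt q := Real.sqrt_pos.2 hqpos
  have hss := Real.mul_self_sqrt hq0
  field_simp
  nlinarith

open Finset MeasureTheory Real Classical in
theorem stmt_13 {d : ℕ} (w : Fin d → ℝ) (hw : ∀ i, 0 < w i)
    (S : Fin d → ℝ) (hS : ∀ i, S i = (2 * π * w i)⁻¹)
    (g : (Fin d → ℝ) → ℝ)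
    (hg : ∀ t, g t = ∏ i, (Real.sqrt (2 * π * S i))⁻¹ * Real.exp (-(t i) ^ 2 / (2 * S i)))
    (f : (Fin d → ℝ) → Bool) (hf : Measurable f)
    (sm : (Fin d → ℝ) → ℝ)
    (hsm : ∀ x, sm x = ∫ t : Fin d → ℝ, (if f (x + t) = true then (1 : ℝ) else 0) * g t) :
    ∀ x ε : Fin d → ℝ,
      |sm (x + ε) - sm x| ≤ Real.sqrt (∑ i, w i * (ε i) ^ 2) := by
  have hS0 : ∀ i, 0 ≤ S i := fun i => by
    rw [hS]; have := hw i; have := Real.pi_pos; positivity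
  have one : ∀ x ε : Fin d → ℝ, sm (x + ε) - sm x ≤ Real.sqrt (∑ i, w i * (ε i) ^ 2) := by
    intro x ε
    have hkm : Measurable (fun t => if f (x + t) = true then (1 : ℝ) else 0) := by
      refine Measurable.ite ?_ measurable_const measurable_const
      exact (hf.comp (measurable_const_add x)) (MeasurableSet.singleton true)
    have h := aux_one_side w hw (fun i => (S i).toNNReal)
      (fun i => by rw [Real.coe_toNNReal _ (hS0 i), hS]) g
      (fun t => by rw [hg]; simp only [ProbabilityTheory.gaussianPDFReal, sub_zero,
        Real.coe_toNNReal _ (hS0 _)])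
      (fun t => if f (x + t) = true then (1 : ℝ) else 0) hkm
      (fun t => by split_ifs <;> norm_num)
      (fun t => by split_ifs <;> norm_num) ε
    have e : ∀ t, x + ε + t = x + (t + ε) := fun t => by abel
    rw [hsm, hsm]
    simp only [e]
    exact h
  intro x ε
  rw [abs_sub_le_iff]
  refine ⟨one x ε, ?_⟩
  have := one (x + ε) (-ε)
  simpa using this
end
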